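/- Let C be a k×l real matrix (1 ≤ l ≤ k) such that every l×l submatrix is nonsingular. For y ∈ ℝ^k let 𝓛*_y : ℝ^l → ℝ^k be (𝓛*_y ζ)(i) = y_i Σ_{j=1}^l c_i^j ζ_j. Then for every ρ ∈ ℝ there is a constant c, depending only on C and ρ, such that for every nonnegative measurable function w : ℝ^k → [0,∞], ∫_{{y : 1 ≤ |y_i| < 2 ∀i}} ∫_{ℝ^l} |ζ|^ρ w(𝓛*_y ζ) dζ dy ≤ c ∫_{ℝ^k} |τ|^{ρ−k+l} w(τ) dτ. -/

import Mathlib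

open MeasureTheory
open scoped ENNReal

/-- Condition (*): every `l × l` submatrix of `C` is nonsingular. -/
def CondStar {k l : ℕ} (C : Matrix (Fin k) (Fin l) ℝ) : Prop :=
  ∀ e : Fin l → Fin k, Function.Injective e →
    (Matrix.of fun a j => C (e a) j).det ≠ 0

theorem lintegral_prod_abs_mul_comp_mul_le {κ : Type*} [Fintype κ] (a : κ → ℝ)
    {f : (κ → ℝ) → ℝ≥0∞} (hf : Measurable f) :
    ∫⁻ u : κ → ℝ, ENNReal.ofReal (∏ i, |a i|) * f (u * a) ≤ ∫⁻ u, f u := by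
  classical
  by_cases ha : (Matrix.diagonal a).det = 0
  · rw [Matrix.det_diagonal] at ha
    simp [← Finset.abs_prod, ha]
  · have h := Real.smul_map_diagonal_volume_pi ha
    have hm : Measurable (Matrix.toLin' (Matrix.diagonal a)) :=
      (LinearMap.continuous_of_finiteDimensional _).measurable
    conv_rhs => rw [← h, lintegral_smul_measure, lintegral_map hf hm]
    rw [lintegral_const_mul _ (by fun_prop), Matrix.det_diagonal, Finset.abs_prod, smul_eq_mul]
    refine le_of_eq ?_
    congr 2
    ext u
    congr 1
    ext i
    simp [Matrix.mulVec_diagonal, mul_comm]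

theorem lintegral_comp_mul_mulVec_le {n : Type*} [Fintype n] [DecidableEq n]
    {B : Matrix n n ℝ} (hB : B.det ≠ 0) {v : n → ℝ} (hv : ∀ i, 1 ≤ |v i|)
    {f : (n → ℝ) → ℝ≥0∞} (hf : Measurable f) :
    ∫⁻ ζ : n → ℝ, f (v * B.mulVec ζ) ≤ ENNReal.ofReal |B.det⁻¹| * ∫⁻ t, f t := by
  have hv' : 1 ≤ |∏ i, v i| := by
    rw [Finset.abs_prod]
    exact Finset.one_le_prod fun i _ => hv i
  have hdet : (Matrix.diagonal v * B).det ≠ 0 := by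
    rw [Matrix.det_mul, Matrix.det_diagonal]
    exact mul_ne_zero (abs_pos.1 (by linarith)) hB
  have h := Real.map_matrix_volume_pi_eq_smul_volume_pi hdet
  have hm : Measurable (Matrix.toLin' (Matrix.diagonal v * B)) :=
    (LinearMap.continuous_of_finiteDimensional _).measurable
  have hcomp : ∀ ζ, v * B.mulVec ζ = Matrix.toLin' (Matrix.diagonal v * B) ζ := by
    intro ζ
    ext i
    simp [Matrix.mulVec_diagonal]
  simp_rw [hcomp]
  rw [← lintegral_map hf hm, h, lintegral_smul_measure, smul_eq_mul]
  refine mul_le_mul_left (ENNReal.ofReal_le_ofReal ?_) _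
  rw [Matrix.det_mul, Matrix.det_diagonal, abs_inv, abs_inv, abs_mul]
  exact inv_anti₀ (abs_pos.2 hB) (le_mul_of_one_le_left (abs_nonneg _) hv')

theorem volume_unit_shell_lt_top {n : Type*} [Fintype n] :
    volume {v : n → ℝ | ∀ i, 1 ≤ |v i| ∧ |v i| < 2} < ⊤ := by
  refine lt_of_le_of_lt (measure_mono ?_)
    (isCompact_Icc (a := fun _ : n => (-2 : ℝ)) (b := fun _ => 2)).measure_lt_top
  exact fun v hv => ⟨fun i => (abs_lt.1 (hv i).2).1.le, fun i => (abs_lt.1 (hv i).2).2.le⟩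

theorem measurableSet_unit_shell {n : Type*} [Fintype n] :
    MeasurableSet {v : n → ℝ | ∀ i, 1 ≤ |v i| ∧ |v i| < 2} := by
  have h : MeasurableSet {x : ℝ | 1 ≤ |x| ∧ |x| < 2} :=
    (measurableSet_le measurable_const measurable_norm).inter
      (measurableSet_lt measurable_norm measurable_const)
  exact MeasurableSet.univ_pi (fun _ : n => h) |>.congr (by ext; simp)

theorem lintegral_shell_prod_le {κ n : Type*} [Fintype κ] [Fintype n] [DecidableEq n]
    (A : Matrix κ n ℝ) {B : Matrix n n ℝ} (hB : B.det ≠ 0)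
    {Ψ : (κ → ℝ) × (n → ℝ) → ℝ≥0∞} (hΨ : Measurable Ψ) :
    ∫⁻ p in Set.univ ×ˢ {v : n → ℝ | ∀ i, 1 ≤ |v i| ∧ |v i| < 2}, ∫⁻ ζ : n → ℝ,
        ENNReal.ofReal (∏ i, |A.mulVec ζ i|) * Ψ (p.1 * A.mulVec ζ, p.2 * B.mulVec ζ)
      ≤ volume {v : n → ℝ | ∀ i, 1 ≤ |v i| ∧ |v i| < 2} * ENNReal.ofReal |B.det⁻¹| *
        ∫⁻ p, Ψ p := by
  have hA : Measurable (A.mulVec) := (Matrix.mulVecLin A).continuous_of_finiteDimensional.measurable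
  have hBm : Measurable (B.mulVec) :=
    (Matrix.mulVecLin B).continuous_of_finiteDimensional.measurable
  have hmeas : Measurable fun q : ((κ → ℝ) × (n → ℝ)) × (n → ℝ) =>
      ENNReal.ofReal (∏ i, |A.mulVec q.2 i|) *
        Ψ (q.1.1 * A.mulVec q.2, q.1.2 * B.mulVec q.2) := by
    fun_prop
  rw [Measure.volume_eq_prod, setLIntegral_prod_symm _ hmeas.lintegral_prod_right'.aemeasurable]
  have hv : ∀ v ∈ {v : n → ℝ | ∀ i, 1 ≤ |v i| ∧ |v i| < 2},
      ∫⁻ u in Set.univ, ∫⁻ ζ : n → ℝ, ENNReal.ofReal (∏ i, |A.mulVec ζ i|) *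
        Ψ (u * A.mulVec ζ, v * B.mulVec ζ) ≤ ENNReal.ofReal |B.det⁻¹| * ∫⁻ p, Ψ p := by
    intro v hv
    rw [Measure.restrict_univ, lintegral_lintegral_swap (by fun_prop)]
    calc _ ≤ ∫⁻ ζ : n → ℝ, ∫⁻ u : κ → ℝ, Ψ (u, v * B.mulVec ζ) := lintegral_mono fun ζ =>
            lintegral_prod_abs_mul_comp_mul_le (A.mulVec ζ)
              (f := fun s => Ψ (s, v * B.mulVec ζ)) (by fun_prop)
      _ = ∫⁻ u : κ → ℝ, ∫⁻ ζ : n → ℝ, Ψ (u, v * B.mulVec ζ) :=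
            lintegral_lintegral_swap (by fun_prop)
      _ ≤ ∫⁻ u : κ → ℝ, ENNReal.ofReal |B.det⁻¹| * ∫⁻ t : n → ℝ, Ψ (u, t) :=
            lintegral_mono fun u => lintegral_comp_mul_mulVec_le hB (fun i => (hv i).1)
              (f := fun t => Ψ (u, t)) (by fun_prop)
      _ = _ := by
            rw [lintegral_const_mul _ hΨ.lintegral_prod_right', Measure.volume_eq_prod,
              lintegral_prod _ hΨ.aemeasurable]
  refine (setLIntegral_mono' measurableSet_unit_shell hv).trans_eq ?_
  rw [setLIntegral_const, Measure.volume_eq_prod]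
  ring

theorem lintegral_shell_le {ι κ n : Type*} [Fintype ι] [Fintype κ] [Fintype n] [DecidableEq n]
    (σ : κ ⊕ n ≃ ι) (C : Matrix ι n ℝ) (hC : (C.submatrix (σ ∘ Sum.inr) id).det ≠ 0)
    {Φ : (ι → ℝ) → ℝ≥0∞} (hΦ : Measurable Φ) :
    ∫⁻ y in {y : ι → ℝ | ∀ i, 1 ≤ |y i| ∧ |y i| < 2}, ∫⁻ ζ : n → ℝ,
        ENNReal.ofReal (∏ i, |C.mulVec ζ (σ (Sum.inl i))|) * Φ (y * C.mulVec ζ)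
      ≤ volume {v : n → ℝ | ∀ i, 1 ≤ |v i| ∧ |v i| < 2} *
        ENNReal.ofReal |(C.submatrix (σ ∘ Sum.inr) id).det⁻¹| * ∫⁻ y, Φ y := by
  let e : (ι → ℝ) ≃ᵐ (κ → ℝ) × (n → ℝ) :=
    (MeasurableEquiv.piCongrLeft (fun _ => ℝ) σ).symm.trans
      (MeasurableEquiv.sumPiEquivProdPi fun _ => ℝ)
  have he : MeasurePreserving e volume volume :=
    ((volume_measurePreserving_piCongrLeft (fun _ => ℝ) σ).symm _).trans
      (volume_measurePreserving_sumPiEquivProdPi fun _ => ℝ)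
  have he_apply : ∀ y, e y = (fun i => y (σ (Sum.inl i)), fun j => y (σ (Sum.inr j))) :=
    fun _ => rfl
  have hΨ : Measurable (Φ ∘ e.symm) := hΦ.comp e.symm.measurable
  have key := lintegral_shell_prod_le (C.submatrix (σ ∘ Sum.inl) id) hC hΨ
  rw [← he.lintegral_comp_emb e.measurableEmbedding,
    ← he.setLIntegral_comp_preimage_emb e.measurableEmbedding] at key
  simp only [Function.comp_apply, MeasurableEquiv.symm_apply_apply] at key
  refine le_trans (lintegral_mono_set
    (t := e ⁻¹' Set.univ ×ˢ {v : n → ℝ | ∀ i, 1 ≤ |v i| ∧ |v i| < 2}) ?_) (le_of_eq_of_le ?_ key)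
  · exact fun y hy => ⟨trivial, fun i => hy _⟩
  · congr 1
    ext y
    congr 1
    ext ζ
    congr 2
    rw [eq_comm, MeasurableEquiv.symm_apply_eq, he_apply, he_apply]
    rfl

theorem CondStar.exists_mulVec_ne_zero {k l : ℕ} {C : Matrix (Fin k) (Fin l) ℝ} (hC : CondStar C)
    {e : Fin l → Fin k} (he : Function.Injective e) {ζ : Fin l → ℝ} (hζ : ζ ≠ 0) :
    ∃ a, C.mulVec ζ (e a) ≠ 0 := by
  by_contra! h
  exact hζ (Matrix.eq_zero_of_mulVec_eq_zero (hC e he) (funext h))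

theorem CondStar.exists_embedding {k l : ℕ} (hlk : l ≤ k) {C : Matrix (Fin k) (Fin l) ℝ}
    (hC : CondStar C) {ζ : Fin l → ℝ} (hζ : ζ ≠ 0) :
    ∃ e : Fin l ↪ Fin k, ∀ i ∉ Set.range e, C.mulVec ζ i ≠ 0 := by
  classical
  let Z : Finset (Fin k) := Finset.univ.filter fun i => C.mulVec ζ i = 0
  have hZ : Z.card ≤ l := by
    by_contra! h
    obtain ⟨T, hTZ, hT⟩ := Finset.exists_subset_card_eq h.le
    obtain ⟨a, ha⟩ := hC.exists_mulVec_ne_zero (T.orderEmbOfFin hT).injective hζ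
    exact ha (Finset.mem_filter.1 (hTZ (T.orderEmbOfFin_mem hT a))).2
  obtain ⟨T, hZT, -, hT⟩ := Finset.exists_subsuperset_card_eq (Finset.subset_univ Z) hZ
    (by simpa using hlk)
  refine ⟨(T.orderEmbOfFin hT).toEmbedding, fun i hi h => hi ?_⟩
  have : i ∈ T := hZT (by simpa [Z] using h)
  simpa using this

theorem CondStar.exists_pow_le_sum_prod {k l : ℕ} (hlk : l ≤ k) {C : Matrix (Fin k) (Fin l) ℝ}
    (hC : CondStar C) [∀ e : Fin l ↪ Fin k, Fintype ↥(Set.range e)ᶜ] :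
    ∃ δ > 0, ∀ ζ : EuclideanSpace ℝ (Fin l), ζ ≠ 0 → δ * ‖ζ‖ ^ (k - l) ≤
      ∑ e : Fin l ↪ Fin k, ∏ i : ↥(Set.range e)ᶜ, |C.mulVec ζ.ofLp i| := by
  let N : EuclideanSpace ℝ (Fin l) → ℝ := fun ζ =>
    ∑ e : Fin l ↪ Fin k, ∏ i : ↥(Set.range e)ᶜ, |C.mulVec ζ.ofLp i|
  have hcont : Continuous N := by
    have : Continuous C.mulVec := (Matrix.mulVecLin C).continuous_of_finiteDimensional
    fun_prop
  have hpos : ∀ ζ ∈ Metric.sphere (0 : EuclideanSpace ℝ (Fin l)) 1, 0 < N ζ := by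
    intro ζ hζ
    have hζ0 : ζ.ofLp ≠ 0 := by
      intro h
      have : ζ = 0 := by ext i; simp [h]
      simp [this] at hζ
    obtain ⟨e, he⟩ := hC.exists_embedding hlk hζ0
    exact Finset.sum_pos' (fun _ _ => Finset.prod_nonneg fun _ _ => abs_nonneg _)
      ⟨e, Finset.mem_univ _, Finset.prod_pos fun i _ => abs_pos.2 (he i i.2)⟩
  obtain ⟨δ, hδ, h⟩ := (isCompact_sphere (0 : EuclideanSpace ℝ (Fin l)) 1).exists_forall_le'
    hcont.continuousOn hpos
  refine ⟨δ, hδ, fun ζ hζ => ?_⟩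
  have hn : 0 < ‖ζ‖ := norm_pos_iff.2 hζ
  have hcard : ∀ e : Fin l ↪ Fin k, Fintype.card ↥(Set.range e)ᶜ = k - l := by
    intro e
    classical
    rw [Fintype.card_compl_set, Set.card_range_of_injective e.injective, Fintype.card_fin,
      Fintype.card_fin]
  have hhom : N ζ = N (‖ζ‖⁻¹ • ζ) * ‖ζ‖ ^ (k - l) := by
    simp only [N, Finset.sum_mul]
    refine Finset.sum_congr rfl fun e _ => ?_
    rw [← hcard e, ← Finset.card_univ, ← Finset.prod_const,
      ← Finset.prod_mul_distrib]
    refine Finset.prod_congr rfl fun i _ => ?_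
    rw [WithLp.ofLp_smul, Matrix.mulVec_smul, Pi.smul_apply, smul_eq_mul, abs_mul, abs_inv,
      abs_norm]
    field_simp
  change _ ≤ N ζ
  rw [hhom]
  gcongr
  exact h _ (by simp [norm_smul, hn.ne'])

theorem rpow_le_mul_rpow_of_comparable {m M : ℝ} (hm : 0 < m) (hM : 0 < M) (s : ℝ) {a b : ℝ}
    (ha : 0 < a) (hb : 0 < b) (h₁ : m * a ≤ b) (h₂ : b ≤ M * a) :
    a ^ s ≤ (m ^ (-s) + M ^ (-s)) * b ^ s := by
  have hm' : a ≤ m⁻¹ * b := by rwa [← div_eq_inv_mul, le_div_iff₀' hm]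
  have hM' : M⁻¹ * b ≤ a := by rwa [← div_eq_inv_mul, div_le_iff₀' hM]
  have hms : m ^ (-s) * b ^ s = (m⁻¹ * b) ^ s := by
    rw [Real.mul_rpow (by positivity) hb.le, Real.inv_rpow hm.le, Real.rpow_neg hm.le]
  have hMs : M ^ (-s) * b ^ s = (M⁻¹ * b) ^ s := by
    rw [Real.mul_rpow (by positivity) hb.le, Real.inv_rpow hM.le, Real.rpow_neg hM.le]
  rw [add_mul, hms, hMs]
  rcases le_total 0 s with hs | hs
  · exact (Real.rpow_le_rpow ha.le hm' hs).trans (le_add_of_nonneg_right (by positivity))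
  · exact (Real.rpow_le_rpow_of_nonpos (by positivity) hM' hs).trans
      (le_add_of_nonneg_left (by positivity))

theorem CondStar.exists_rpow_norm_le {k l : ℕ} (hlk : l ≤ k) {C : Matrix (Fin k) (Fin l) ℝ}
    (hC : CondStar C) (s : ℝ) :
    ∃ K > 0, ∀ y : Fin k → ℝ, (∀ i, 1 ≤ |y i| ∧ |y i| < 2) → ∀ ζ : EuclideanSpace ℝ (Fin l),
      ζ ≠ 0 → ‖ζ‖ ^ s ≤ K * ‖WithLp.toLp 2 (y * C.mulVec ζ.ofLp)‖ ^ s := by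
  let f : EuclideanSpace ℝ (Fin l) →ₗ[ℝ] EuclideanSpace ℝ (Fin k) := Matrix.toLpLin 2 2 C
  have hf : ∀ ζ, f ζ = WithLp.toLp 2 (C.mulVec ζ.ofLp) := fun _ => rfl
  have hker : f.ker = ⊥ := by
    refine LinearMap.ker_eq_bot'.2 fun ζ h => ?_
    by_contra hζ
    have hζ0 : ζ.ofLp ≠ 0 := fun h => hζ (by ext i; simp [h])
    obtain ⟨a, ha⟩ := hC.exists_mulVec_ne_zero (Fin.castLE_injective hlk) hζ0
    rw [hf] at h
    exact ha (congrArg (fun τ : EuclideanSpace ℝ (Fin k) => τ (Fin.castLE hlk a)) h)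
  obtain ⟨K, hK, hanti⟩ := f.exists_antilipschitzWith hker
  obtain ⟨M, hM, hbound⟩ := f.toContinuousLinearMap.bound
  have hK' : (0 : ℝ) < K := hK
  refine ⟨_, by positivity, fun y hy ζ hζ => rpow_le_mul_rpow_of_comparable
    (m := (K : ℝ)⁻¹) (M := 2 * M) (by positivity) (by positivity) s (norm_pos_iff.2 hζ) ?_ ?_ ?_⟩
  all_goals
    have hζn := norm_pos_iff.2 hζ
    have hlow : ‖ζ‖ ≤ K * ‖f ζ‖ := by simpa using hanti.le_mul_dist ζ 0
    have hupp : ‖f ζ‖ ≤ M * ‖ζ‖ := hbound ζ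
    have h₁ : ‖f ζ‖ ≤ ‖WithLp.toLp 2 (y * C.mulVec ζ.ofLp)‖ := by
      rw [hf, EuclideanSpace.norm_eq, EuclideanSpace.norm_eq]
      gcongr with i
      simpa using le_mul_of_one_le_left (abs_nonneg _) (hy i).1
    have h₂ : ‖WithLp.toLp 2 (y * C.mulVec ζ.ofLp)‖ ≤ 2 * ‖f ζ‖ := by
      rw [← Real.norm_ofNat 2, ← norm_smul, hf, EuclideanSpace.norm_eq, EuclideanSpace.norm_eq]
      gcongr with i
      simpa using mul_le_mul_of_nonneg_right (hy i).2.le (abs_nonneg _)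
  · exact (pos_of_mul_pos_right (hζn.trans_le hlow) hK'.le).trans_le h₁
  · rw [inv_mul_le_iff₀ hK']
    exact hlow.trans (by gcongr)
  · linarith

theorem stmt_6 (k l : ℕ) (hl : 1 ≤ l) (hlk : l ≤ k)
    (C : Matrix (Fin k) (Fin l) ℝ) (hC : CondStar C) (ρ : ℝ) :
    ∃ c : ℝ≥0∞, c ≠ ⊤ ∧
      ∀ w : EuclideanSpace ℝ (Fin k) → ℝ≥0∞, Measurable w →
        (∫⁻ y in {y : EuclideanSpace ℝ (Fin k) | ∀ i, 1 ≤ |y i| ∧ |y i| < 2},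
            ∫⁻ ζ : EuclideanSpace ℝ (Fin l),
              ENNReal.ofReal (‖ζ‖ ^ ρ) *
                w ((WithLp.equiv 2 (Fin k → ℝ)).symm fun i => y i * ∑ j, C i j * ζ j)
              ∂volume ∂volume)
          ≤ c * ∫⁻ τ : EuclideanSpace ℝ (Fin k),
              ENNReal.ofReal (‖τ‖ ^ (ρ - k + l)) * w τ ∂volume := by
  classical
  obtain ⟨δ, hδ, hprod⟩ := hC.exists_pow_le_sum_prod hlk
  obtain ⟨K, hK, hnorm⟩ := hC.exists_rpow_norm_le hlk (ρ - k + l)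
  let σ : (e : Fin l ↪ Fin k) → ↥(Set.range e)ᶜ ⊕ Fin l ≃ Fin k := fun e =>
    ((Equiv.sumComm _ _).trans ((Equiv.ofInjective e e.injective).sumCongr (Equiv.refl _))).trans
      (Equiv.Set.sumCompl (Set.range e))
  have hdet : ∀ e, (C.submatrix (σ e ∘ Sum.inr) id).det ≠ 0 := fun e => hC e e.injective
  let c : (Fin l ↪ Fin k) → ℝ≥0∞ := fun e =>
    volume {v : Fin l → ℝ | ∀ i, 1 ≤ |v i| ∧ |v i| < 2} *
      ENNReal.ofReal |(C.submatrix (σ e ∘ Sum.inr) id).det⁻¹|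
  refine ⟨ENNReal.ofReal (δ⁻¹ * K) * ∑ e, c e, ENNReal.mul_ne_top ENNReal.ofReal_ne_top
    (ENNReal.sum_ne_top.2 fun e _ => ENNReal.mul_ne_top volume_unit_shell_lt_top.ne
      ENNReal.ofReal_ne_top), fun w hw => ?_⟩
  let Φ : (Fin k → ℝ) → ℝ≥0∞ := fun τ =>
    ENNReal.ofReal (‖WithLp.toLp 2 τ‖ ^ (ρ - k + l)) * w (WithLp.toLp 2 τ)
  have hΦ : Measurable Φ := by fun_prop
  have hCm : Measurable C.mulVec :=
    (Matrix.mulVecLin C).continuous_of_finiteDimensional.measurable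
  have hmeas : ∀ e : Fin l ↪ Fin k, Measurable fun q : (Fin k → ℝ) × (Fin l → ℝ) =>
      ENNReal.ofReal (∏ i : ↥(Set.range e)ᶜ, |C.mulVec q.2 i|) * Φ (q.1 * C.mulVec q.2) := by
    intro e
    fun_prop
  let H : (Fin k → ℝ) → (Fin l → ℝ) → ℝ≥0∞ := fun y ζ =>
    ∑ e : Fin l ↪ Fin k,
      ENNReal.ofReal (∏ i : ↥(Set.range e)ᶜ, |C.mulVec ζ i|) * Φ (y * C.mulVec ζ)
  have hpoint : ∀ y : Fin k → ℝ, (∀ i, 1 ≤ |y i| ∧ |y i| < 2) →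
      ∀ ζ : EuclideanSpace ℝ (Fin l), ζ ≠ 0 →
        ENNReal.ofReal (‖ζ‖ ^ ρ) * w (WithLp.toLp 2 (y * C.mulVec ζ.ofLp)) ≤
          ENNReal.ofReal (δ⁻¹ * K) * H y ζ.ofLp := by
    intro y hy ζ hζ
    have hn : 0 < ‖ζ‖ := norm_pos_iff.2 hζ
    have hsplit : ‖ζ‖ ^ ρ = ‖ζ‖ ^ (k - l) * ‖ζ‖ ^ (ρ - k + l) := by
      rw [← Real.rpow_natCast, ← Real.rpow_add hn, Nat.cast_sub hlk]
      ring_nf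
    have hle : ‖ζ‖ ^ ρ ≤ δ⁻¹ * K *
        ((∑ e : Fin l ↪ Fin k, ∏ i : ↥(Set.range e)ᶜ, |C.mulVec ζ.ofLp i|) *
          ‖WithLp.toLp 2 (y * C.mulVec ζ.ofLp)‖ ^ (ρ - k + l)) := by
      have h₁ := (le_inv_mul_iff₀ hδ).2 (hprod ζ hζ)
      rw [hsplit]
      refine (mul_le_mul h₁ (hnorm y hy ζ hζ) (by positivity)
        ((by positivity : (0 : ℝ) ≤ ‖ζ‖ ^ (k - l)).trans h₁)).trans_eq ?_
      ring
    refine (mul_le_mul_left (ENNReal.ofReal_le_ofReal hle) _).trans_eq ?_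
    simp only [H, Φ]
    have hS : 0 ≤ ∑ e : Fin l ↪ Fin k, ∏ i : ↥(Set.range e)ᶜ, |C.mulVec ζ.ofLp i| :=
      Finset.sum_nonneg fun e _ => Finset.prod_nonneg fun i _ => abs_nonneg _
    rw [ENNReal.ofReal_mul (by positivity : 0 ≤ δ⁻¹ * K), ENNReal.ofReal_mul hS,
      ENNReal.ofReal_sum_of_nonneg fun e _ => Finset.prod_nonneg fun i _ => abs_nonneg _,
      ← Finset.sum_mul]
    ring
  have hl0 : NeZero l := ⟨by omega⟩
  have hinner : ∀ y : Fin k → ℝ, (∀ i, 1 ≤ |y i| ∧ |y i| < 2) →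
      ∫⁻ ζ : EuclideanSpace ℝ (Fin l),
          ENNReal.ofReal (‖ζ‖ ^ ρ) * w (WithLp.toLp 2 (y * C.mulVec ζ.ofLp)) ≤
        ENNReal.ofReal (δ⁻¹ * K) * ∫⁻ ζ, H y ζ := by
    intro y hy
    rw [← lintegral_const_mul' _ _ ENNReal.ofReal_ne_top,
      ← (PiLp.volume_preserving_ofLp (Fin l)).lintegral_comp_emb
        (MeasurableEquiv.toLp 2 (Fin l → ℝ)).symm.measurableEmbedding]
    refine lintegral_mono_ae ?_
    filter_upwards [Measure.ae_ne volume 0] with ζ hζ using hpoint y hy ζ hζ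
  have hshell : MeasurableSet {y : Fin k → ℝ | ∀ i, 1 ≤ |y i| ∧ |y i| < 2} :=
    measurableSet_unit_shell
  have hRHS : ∫⁻ τ : EuclideanSpace ℝ (Fin k),
      ENNReal.ofReal (‖τ‖ ^ (ρ - k + l)) * w τ = ∫⁻ τ, Φ τ :=
    (PiLp.volume_preserving_ofLp (Fin k)).lintegral_comp_emb
      (MeasurableEquiv.toLp 2 (Fin k → ℝ)).symm.measurableEmbedding Φ
  rw [hRHS]
  calc _ = ∫⁻ y in {y : Fin k → ℝ | ∀ i, 1 ≤ |y i| ∧ |y i| < 2},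
        ∫⁻ ζ : EuclideanSpace ℝ (Fin l),
          ENNReal.ofReal (‖ζ‖ ^ ρ) * w (WithLp.toLp 2 (y * C.mulVec ζ.ofLp)) :=
        (PiLp.volume_preserving_ofLp (Fin k)).setLIntegral_comp_preimage_emb
          (MeasurableEquiv.toLp 2 (Fin k → ℝ)).symm.measurableEmbedding
          (fun y => ∫⁻ ζ : EuclideanSpace ℝ (Fin l),
            ENNReal.ofReal (‖ζ‖ ^ ρ) * w (WithLp.toLp 2 (y * C.mulVec ζ.ofLp)))
          {y : Fin k → ℝ | ∀ i, 1 ≤ |y i| ∧ |y i| < 2}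
    _ ≤ ∫⁻ y in {y : Fin k → ℝ | ∀ i, 1 ≤ |y i| ∧ |y i| < 2},
          ENNReal.ofReal (δ⁻¹ * K) * ∫⁻ ζ, H y ζ := setLIntegral_mono' hshell hinner
    _ = ENNReal.ofReal (δ⁻¹ * K) * ∑ e : Fin l ↪ Fin k,
          ∫⁻ y in {y : Fin k → ℝ | ∀ i, 1 ≤ |y i| ∧ |y i| < 2}, ∫⁻ ζ : Fin l → ℝ,
            ENNReal.ofReal (∏ i : ↥(Set.range e)ᶜ, |C.mulVec ζ i|) * Φ (y * C.mulVec ζ) := by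
        rw [lintegral_const_mul' _ _ ENNReal.ofReal_ne_top,
          ← lintegral_finsetSum _ fun e _ => (hmeas e).lintegral_prod_right']
        congr 2
        ext y
        exact lintegral_finsetSum _ fun e _ => by fun_prop
    _ ≤ ENNReal.ofReal (δ⁻¹ * K) * ∑ e, c e * ∫⁻ τ, Φ τ := by
        gcongr with e
        exact lintegral_shell_le (σ e) C (hdet e) hΦ
    _ = _ := by rw [← Finset.sum_mul, mul_assoc]
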